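/- For the real Bohnenblust–Hille constants C, the sequence n ↦ C_{2n+1} / (C_n^(n/(2n+1)) · C_{n+1}^((n+1)/(2n+1))) converges to e^(1 − γ/2)/√2 as n → ∞. -/

import Mathlib

open Real Filter

/-- The Khinchine-inequality constant `A_p = √2 · (Γ((p+1)/2)/√π)^(1/p)`. -/
noncomputable def khinchineA (p : ℝ) : ℝ :=
  Real.sqrt 2 * (Real.Gamma ((p + 1) / 2) / Real.sqrt π) ^ (1 / p)

/-- The real Bohnenblust–Hille constants: `C 1 = 1`, `C 2 = √2`, `C 3 = 2^(5/6)`,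
`C m = C (m/2) / A_{2m/(m+2)}^(m/2)` for even `m ≥ 4`, and
`C m = (C ((m−1)/2) / A_{(2m−2)/(m+1)}^((m+1)/2))^((m−1)/(2m)) ·
       (C ((m+1)/2) / A_{(2m+2)/(m+3)}^((m−1)/2))^((m+1)/(2m))` for odd `m ≥ 5`. -/
noncomputable def bhConstR : ℕ → ℝ
  | m =>
    if _h1 : m ≤ 1 then 1
    else if _h2 : m = 2 then Real.sqrt 2
    else if _h3 : m = 3 then (2 : ℝ) ^ ((5 : ℝ) / 6)
    else if _h4 : m % 2 = 0 then
      bhConstR (m / 2) / khinchineA (2 * (m : ℝ) / ((m : ℝ) + 2)) ^ ((m : ℝ) / 2)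
    else
      (bhConstR ((m - 1) / 2) /
          khinchineA ((2 * (m : ℝ) - 2) / ((m : ℝ) + 1)) ^ (((m : ℝ) + 1) / 2)) ^
        (((m : ℝ) - 1) / (2 * (m : ℝ))) *
      (bhConstR ((m + 1) / 2) /
          khinchineA ((2 * (m : ℝ) + 2) / ((m : ℝ) + 3)) ^ (((m : ℝ) - 1) / 2)) ^
        (((m : ℝ) + 1) / (2 * (m : ℝ)))
  termination_by m => m
  decreasing_by all_goals omega


theorem khA_pos {p : ℝ} (hp : 0 < p) : 0 < khinchineA p := by
  unfold khinchineA
  have : 0 < Real.Gamma ((p + 1) / 2) := Real.Gamma_pos_of_pos (by linarith)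
  positivity

theorem bh_pos (m : ℕ) : 0 < bhConstR m := by
  induction m using Nat.strong_induction_on with
  | _ m ih =>
    rw [bhConstR]
    split_ifs with h1 h2 h3 h4
    · norm_num
    · positivity
    · positivity
    · have hm : (4:ℝ) ≤ m := by exact_mod_cast (by omega : 4 ≤ m)
      have := ih (m / 2) (by omega)
      have : 0 < khinchineA (2 * (m : ℝ) / ((m : ℝ) + 2)) := khA_pos (by positivity)
      positivity
    · have hm : (4:ℝ) ≤ m := by exact_mod_cast (by omega : 4 ≤ m)
      have := ih ((m - 1) / 2) (by omega)
      have := ih ((m + 1) / 2) (by omega)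
      have : 0 < khinchineA ((2 * (m : ℝ) - 2) / ((m : ℝ) + 1)) :=
        khA_pos (div_pos (by linarith) (by linarith))
      have : 0 < khinchineA ((2 * (m : ℝ) + 2) / ((m : ℝ) + 3)) := khA_pos (by positivity)
      positivity

theorem Gamma_three_half : Real.Gamma (3 / 2) = √π / 2 := by
  rw [show (3 / 2 : ℝ) = 1 / 2 + 1 by norm_num, Real.Gamma_add_one (by norm_num),
    Real.Gamma_one_half_eq]
  ring

theorem hasDerivAt_Gamma_three_half : HasDerivAt Real.Gamma
    (√π / 2 * (2 - Real.eulerMascheroniConstant - 2 * Real.log 2)) (3 / 2) := by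
  have h := Real.hasDerivAt_Gamma_one_half
  have h2 : HasDerivAt (fun s : ℝ => (s - 1) * Real.Gamma (s - 1))
      (√π / 2 * (2 - Real.eulerMascheroniConstant - 2 * Real.log 2)) (3 / 2) := by
    have ha : HasDerivAt (fun s : ℝ => s - 1) 1 (3 / 2) := (hasDerivAt_id _).sub_const 1
    have hb : HasDerivAt (fun s : ℝ => Real.Gamma (s - 1))
        (-√π * (Real.eulerMascheroniConstant + 2 * Real.log 2) * 1) (3 / 2) :=
      HasDerivAt.comp (h₂ := Real.Gamma) (3 / 2 : ℝ) (by norm_num; norm_num at h; exact h) ha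
    refine (ha.mul hb).congr_deriv ?_
    rw [show (3 / 2 - 1 : ℝ) = 1 / 2 by norm_num, Real.Gamma_one_half_eq]
    ring
  refine h2.congr_of_eventuallyEq ?_
  filter_upwards [lt_mem_nhds (show (1:ℝ) < 3 / 2 by norm_num)] with s hs
  rw [← Real.Gamma_add_one (by linarith)]
  ring_nf

theorem log_khA {p : ℝ} (hp : 0 < p) : Real.log (khinchineA p) =
    Real.log 2 / 2 + 1 / p * Real.log (Real.Gamma ((p + 1) / 2) / √π) := by
  unfold khinchineA
  have : 0 < Real.Gamma ((p + 1) / 2) := Real.Gamma_pos_of_pos (by linarith)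
  rw [Real.log_mul (by positivity) (by positivity), Real.log_rpow (by positivity),
    Real.log_sqrt (by norm_num)]

theorem log_khA_two : Real.log (khinchineA 2) = 0 := by
  have : √π ≠ 0 := by positivity
  rw [log_khA (by norm_num), show ((2:ℝ) + 1) / 2 = 3 / 2 by norm_num, Gamma_three_half,
    show √π / 2 / √π = (2:ℝ)⁻¹ by field_simp, Real.log_inv]
  ring

theorem hasDerivAt_log_khA : HasDerivAt (fun p => Real.log (khinchineA p))
    ((2 - Real.eulerMascheroniConstant - Real.log 2) / 4) 2 := by
  have hpi : √π ≠ 0 := by positivity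
  have hf : HasDerivAt (fun p : ℝ => Real.log 2 / 2 +
      p⁻¹ * Real.log (Real.Gamma ((p + 1) / 2) / √π))
      ((2 - Real.eulerMascheroniConstant - Real.log 2) / 4) 2 := by
    have ha : HasDerivAt (fun p : ℝ => (p + 1) / 2) (1 / 2) 2 :=
      ((hasDerivAt_id _).add_const 1).div_const 2
    have hb : HasDerivAt (fun p : ℝ => Real.Gamma ((p + 1) / 2)) _ 2 :=
      HasDerivAt.comp (h₂ := Real.Gamma) (2 : ℝ)
        (by rw [show ((2:ℝ) + 1) / 2 = 3 / 2 by norm_num]; exact hasDerivAt_Gamma_three_half) ha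
    have e : ((2:ℝ) + 1) / 2 = 3 / 2 := by norm_num
    have hc := (hb.div_const √π).log (by rw [e, Gamma_three_half]; positivity)
    have hd := ((hasDerivAt_inv (show (2:ℝ) ≠ 0 by norm_num)).mul hc).const_add (Real.log 2 / 2)
    refine hd.congr_deriv ?_
    rw [e, Gamma_three_half, show √π / 2 / √π = (2:ℝ)⁻¹ by field_simp, Real.log_inv]
    field_simp
    ring
  refine hf.congr_of_eventuallyEq ?_
  filter_upwards [lt_mem_nhds (show (0:ℝ) < 2 by norm_num)] with p hp
  rw [log_khA hp, one_div]

theorem lim_aux (w h : ℕ → ℝ) (h0 : ∀ n, h n ≠ 0) (hh : Tendsto h atTop (nhds 0))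
    (hw : Tendsto (fun n => w n * h n) atTop (nhds (-1))) :
    Tendsto (fun n => w n * Real.log (khinchineA (2 + h n))) atTop
      (nhds (-1 * ((2 - Real.eulerMascheroniConstant - Real.log 2) / 4))) := by
  have hs := hasDerivAt_log_khA.tendsto_slope_zero
  have h1 : Tendsto h atTop (nhdsWithin 0 {0}ᶜ) :=
    tendsto_nhdsWithin_iff.2 ⟨hh, Eventually.of_forall h0⟩
  refine (hw.mul (hs.comp h1)).congr fun n => ?_
  have := h0 n
  simp only [Function.comp, log_khA_two, smul_eq_mul]
  field_simp
  ring

theorem ratio_eq (n : ℕ) (hn : 2 ≤ n) :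
    bhConstR (2 * n + 1) /
          (bhConstR n ^ ((n : ℝ) / (2 * (n : ℝ) + 1)) *
            bhConstR (n + 1) ^ (((n : ℝ) + 1) / (2 * (n : ℝ) + 1))) =
    Real.exp (-(((n:ℝ) * (n + 1) / (2 * n + 1)) * Real.log (khinchineA (2 + -2 / ((n:ℝ) + 1))) +
      ((n:ℝ) * (n + 1) / (2 * n + 1)) * Real.log (khinchineA (2 + -2 / ((n:ℝ) + 2))))) := by
  have hn' : (2:ℝ) ≤ n := by exact_mod_cast hn
  rw [bhConstR, dif_neg (by omega), dif_neg (by omega), dif_neg (by omega), dif_neg (by omega),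
    show (2 * n + 1 - 1) / 2 = n by omega, show (2 * n + 1 + 1) / 2 = n + 1 by omega]
  push_cast
  rw [show (2 * (2 * (n:ℝ) + 1) - 2) / (2 * (n:ℝ) + 1 + 1) = 2 + -2 / ((n:ℝ) + 1) by
      field_simp; ring,
    show (2 * (2 * (n:ℝ) + 1) + 2) / (2 * (n:ℝ) + 1 + 3) = 2 + -2 / ((n:ℝ) + 2) by
      field_simp; ring,
    show (2 * (n:ℝ) + 1 - 1) / (2 * (2 * (n:ℝ) + 1)) = n / (2 * n + 1) by field_simp; ring,
    show (2 * (n:ℝ) + 1 + 1) / (2 * (2 * (n:ℝ) + 1)) = (n + 1) / (2 * n + 1) by field_simp; ring,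
    show (2 * (n:ℝ) + 1 + 1) / 2 = n + 1 by ring,
    show (2 * (n:ℝ) + 1 - 1) / 2 = n by ring]
  have p1 : 0 < khinchineA (2 + -2 / ((n:ℝ) + 1)) := khA_pos (by
    rw [show 2 + -2 / ((n:ℝ) + 1) = 2 * n / (n + 1) by field_simp; ring]; positivity)
  have p2 : 0 < khinchineA (2 + -2 / ((n:ℝ) + 2)) := khA_pos (by
    rw [show 2 + -2 / ((n:ℝ) + 2) = 2 * (n + 1) / (n + 2) by field_simp; ring]; positivity)
  have c1 := bh_pos n
  have c2 := bh_pos (n + 1)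
  generalize khinchineA (2 + -2 / ((n:ℝ) + 1)) = a at *
  generalize khinchineA (2 + -2 / ((n:ℝ) + 2)) = b at *
  generalize bhConstR n = c at *
  generalize bhConstR (n + 1) = d at *
  apply Real.log_injOn_pos
  · simp only [Set.mem_Ioi]; positivity
  · simp only [Set.mem_Ioi]; positivity
  rw [Real.log_exp, Real.log_div (by positivity) (by positivity),
    Real.log_mul (by positivity) (by positivity), Real.log_mul (by positivity) (by positivity),
    Real.log_rpow (by positivity), Real.log_rpow (by positivity), Real.log_rpow (by positivity),
    Real.log_rpow (by positivity), Real.log_div (by positivity) (by positivity),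
    Real.log_div (by positivity) (by positivity), Real.log_rpow (by positivity),
    Real.log_rpow (by positivity)]
  field_simp
  ring

/-- `C_{2n+1} / (C_n^(n/(2n+1)) · C_{n+1}^((n+1)/(2n+1)))` converges to `e^(1 − γ/2)/√2`. -/
theorem bhConstR_ratio_two_mul_add_one :
    Tendsto
      (fun n : ℕ =>
        bhConstR (2 * n + 1) /
          (bhConstR n ^ ((n : ℝ) / (2 * (n : ℝ) + 1)) *
            bhConstR (n + 1) ^ (((n : ℝ) + 1) / (2 * (n : ℝ) + 1))))
      atTop
      (nhds (Real.exp (1 - Real.eulerMascheroniConstant / 2) / Real.sqrt 2)) := by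
  have t0 : Tendsto (fun n : ℕ => ((n:ℝ))⁻¹) atTop (nhds 0) := tendsto_inv_atTop_nhds_zero_nat
  have hz : ∀ c : ℝ, 0 < c → Tendsto (fun n : ℕ => -2 / ((n:ℝ) + c)) atTop (nhds 0) := by
    intro c hc
    exact Tendsto.const_div_atTop (tendsto_atTop_add_const_right _ _ tendsto_natCast_atTop_atTop) _
  have hw : ∀ c : ℝ, 0 < c → Tendsto (fun n : ℕ => ((n:ℝ) * (n + 1) / (2 * n + 1)) *
      (-2 / ((n:ℝ) + c))) atTop (nhds (-1)) := by
    intro c hc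
    have : Tendsto (fun n : ℕ => (-2) * (1 + ((n:ℝ))⁻¹) / ((2 + (n:ℝ)⁻¹) * (1 + c * (n:ℝ)⁻¹)))
        atTop (nhds ((-2) * (1 + 0) / ((2 + 0) * (1 + c * 0)))) :=
      ((t0.const_add 1).const_mul (-2)).div
        ((t0.const_add 2).mul ((t0.const_mul c).const_add 1)) (by norm_num)
    rw [show (-2) * (1 + 0) / ((2 + 0) * (1 + c * 0)) = (-1 : ℝ) by norm_num] at this
    refine this.congr' ?_
    filter_upwards [eventually_gt_atTop 0] with n hn
    have : (0:ℝ) < n := by exact_mod_cast hn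
    field_simp
  have l1 := lim_aux _ _ (fun n => by
    have : (0:ℝ) < (n:ℝ) + 1 := by positivity
    exact div_ne_zero (by norm_num) this.ne') (hz 1 one_pos) (hw 1 one_pos)
  have l2 := lim_aux _ _ (fun n => by
    have : (0:ℝ) < (n:ℝ) + 2 := by positivity
    exact div_ne_zero (by norm_num) this.ne') (hz 2 two_pos) (hw 2 two_pos)
  have key := (Real.continuous_exp.tendsto _).comp (l1.add l2).neg
  have e : Real.exp (1 - Real.eulerMascheroniConstant / 2) / Real.sqrt 2 =
      Real.exp (-(-1 * ((2 - Real.eulerMascheroniConstant - Real.log 2) / 4) +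
        -1 * ((2 - Real.eulerMascheroniConstant - Real.log 2) / 4))) := by
    rw [show √2 = Real.exp (Real.log 2 / 2) by
      rw [← Real.log_sqrt (by norm_num), Real.exp_log (by positivity)], ← Real.exp_sub]
    congr 1
    ring
  rw [e]
  refine key.congr' ?_
  filter_upwards [eventually_ge_atTop 2] with n hn
  exact (ratio_eq n hn).symm
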